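/- arXiv:1712.07561 — 3 statements merged into one kernel-verified Lean document; each statement's English description precedes it below -/
import Mathlib

section
/- Suppose β ≠ 0 and set λ = (2α+β)/β. If K : (0,∞) × (p₀,∞) → ℝ is continuously differentiable and satisfies the bulk-modulus symmetry PDE β·ρ·∂K/∂ρ + (2α+β)·(p−p₀)·∂K/∂p = (2α+β)·K at every point, then for all ρ > 0 and p > p₀ one has K(ρ,p) = ρ^λ · K(1, p₀ + (p−p₀)·ρ^{−λ}). In particular, K(ρ,p) = (p−p₀)·f((p−p₀)·ρ^{−λ}) where f(w) := K(1, p₀ + w)/w for w > 0. -/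
/-- The chain rule along a plane curve, in terms of the partial derivatives. -/
theorem hasDerivAt_comp_curve {F : ℝ → ℝ → ℝ} {u v : ℝ → ℝ} {u' v' t : ℝ}
    (hF : DifferentiableAt ℝ (fun q : ℝ × ℝ => F q.1 q.2) (u t, v t))
    (hu : HasDerivAt u u' t) (hv : HasDerivAt v v' t) :
    HasDerivAt (fun s => F (u s) (v s))
      (u' * deriv (fun x => F x (v t)) (u t) + v' * deriv (fun y => F (u t) y) (v t)) t := by
  set L := fderiv ℝ (fun q : ℝ × ℝ => F q.1 q.2) (u t, v t) with hL
  have hF' : HasFDerivAt (fun q : ℝ × ℝ => F q.1 q.2) L (u t, v t) := hF.hasFDerivAt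
  have h₁ : HasDerivAt (fun x => F x (v t)) (L (1, 0)) (u t) :=
    hF'.comp_hasDerivAt (f := fun x => (x, v t)) (u t)
      ((hasDerivAt_id (u t)).prodMk (hasDerivAt_const (u t) (v t)))
  have h₂ : HasDerivAt (fun y => F (u t) y) (L (0, 1)) (v t) :=
    hF'.comp_hasDerivAt (f := fun y => (u t, y)) (v t)
      ((hasDerivAt_const (v t) (u t)).prodMk (hasDerivAt_id (v t)))
  have h : HasDerivAt (fun s => F (u s) (v s)) (L (u', v')) t :=
    hF'.comp_hasDerivAt (f := fun s => (u s, v s)) t (hu.prodMk hv)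
  have hlin : L (u', v') = u' * L (1, 0) + v' * L (0, 1) := by
    rw [← smul_eq_mul, ← smul_eq_mul, ← map_smul, ← map_smul, ← map_add]
    simp
  rw [h₁.deriv, h₂.deriv, ← hlin]
  exact h

/-- Along each characteristic `p = p₀ + c * t ^ lam`, a solution of
`ρ ∂K/∂ρ + lam (p - p₀) ∂K/∂p = lam K` is a constant multiple of `t ^ lam`. -/
theorem eq_rpow_mul_on_characteristic {p₀ lam : ℝ} {K : ℝ → ℝ → ℝ}
    (hK : DifferentiableOn ℝ (fun q : ℝ × ℝ => K q.1 q.2) (Set.Ioi 0 ×ˢ Set.Ioi p₀))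
    (hpde : ∀ ρ p : ℝ, 0 < ρ → p₀ < p →
      ρ * deriv (fun x => K x p) ρ + lam * (p - p₀) * deriv (fun y => K ρ y) p = lam * K ρ p)
    {c t : ℝ} (hc : 0 < c) (ht : 0 < t) :
    K t (p₀ + c * t ^ lam) = t ^ lam * K 1 (p₀ + c) := by
  have hderiv : ∀ s ∈ Set.Ioi (0 : ℝ),
      HasDerivAt (fun s => s ^ (-lam) * K s (p₀ + c * s ^ lam)) 0 s := by
    intro s (hs : 0 < s)
    have hp : p₀ < p₀ + c * s ^ lam := lt_add_of_pos_right _ (by positivity)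
    have hdiff : DifferentiableAt ℝ (fun q : ℝ × ℝ => K q.1 q.2) (s, p₀ + c * s ^ lam) :=
      hK.differentiableAt ((isOpen_Ioi.prod isOpen_Ioi).mem_nhds ⟨hs, hp⟩)
    have hv : HasDerivAt (fun s => p₀ + c * s ^ lam) (c * (lam * s ^ (lam - 1))) s :=
      ((Real.hasDerivAt_rpow_const (Or.inl hs.ne')).const_mul c).const_add p₀
    have hcurve := hasDerivAt_comp_curve (u := fun s => s) hdiff (hasDerivAt_id s) hv
    have hpow : HasDerivAt (fun s : ℝ => s ^ (-lam)) (-lam * s ^ (-lam - 1)) s :=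
      Real.hasDerivAt_rpow_const (Or.inl hs.ne')
    refine (hpow.mul hcurve).congr_deriv ?_
    have h := hpde s _ hs hp
    rw [Real.rpow_sub_one hs.ne', Real.rpow_sub_one hs.ne']
    rw [add_sub_cancel_left] at h
    field_simp
    linear_combination s ^ (-lam) * h
  have hconst := isOpen_Ioi.is_const_of_deriv_eq_zero isPreconnected_Ioi
    (fun s hs => (hderiv s hs).differentiableAt.differentiableWithinAt)
    (fun s hs => (hderiv s hs).deriv) (Set.mem_Ioi.2 ht) (Set.mem_Ioi.2 one_pos)
  simp only [Real.one_rpow, one_mul, mul_one] at hconst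
  rw [← hconst, ← mul_assoc, ← Real.rpow_add ht, add_neg_cancel, Real.rpow_zero, one_mul]


/-- If `β ≠ 0`, `λ = (2α+β)/β`, and `K` is a continuously differentiable
solution of the bulk-modulus symmetry PDE on `(0,∞) × (p₀,∞)`, then
`K(ρ,p) = ρ^λ · K(1, p₀ + (p−p₀)·ρ^{−λ})`; in particular
`K(ρ,p) = (p−p₀)·f((p−p₀)·ρ^{−λ})` with `f(w) = K(1, p₀+w)/w`. -/
theorem stmt_1 (α β p₀ : ℝ) (hβ : β ≠ 0) (lam : ℝ) (hlam : lam = (2 * α + β) / β)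
    (K : ℝ → ℝ → ℝ)
    (hK : ContDiffOn ℝ 1 (fun q : ℝ × ℝ => K q.1 q.2) (Set.Ioi 0 ×ˢ Set.Ioi p₀))
    (hpde : ∀ ρ p : ℝ, 0 < ρ → p₀ < p →
      β * ρ * deriv (fun x : ℝ => K x p) ρ
        + (2 * α + β) * (p - p₀) * deriv (fun y : ℝ => K ρ y) p
      = (2 * α + β) * K ρ p) :
    ∀ ρ p : ℝ, 0 < ρ → p₀ < p →
      K ρ p = ρ ^ lam * K 1 (p₀ + (p - p₀) * ρ ^ (-lam)) ∧
      K ρ p = (p - p₀) *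
        ((fun w : ℝ => K 1 (p₀ + w) / w) ((p - p₀) * ρ ^ (-lam))) := by
  intro ρ p hρ hp
  have hp' : 0 < p - p₀ := sub_pos.2 hp
  have hpow : ρ ^ (-lam) * ρ ^ lam = 1 := by
    rw [← Real.rpow_add hρ, neg_add_cancel, Real.rpow_zero]
  have hpde' : ∀ ρ p : ℝ, 0 < ρ → p₀ < p →
      ρ * deriv (fun x => K x p) ρ + lam * (p - p₀) * deriv (fun y => K ρ y) p
        = lam * K ρ p := by
    intro ρ p hρ hp
    have h := hpde ρ p hρ hp
    rw [hlam]
    field_simp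
    linear_combination h
  have hmain : K ρ p = ρ ^ lam * K 1 (p₀ + (p - p₀) * ρ ^ (-lam)) := by
    have h := eq_rpow_mul_on_characteristic (hK.differentiableOn one_ne_zero) hpde'
      (c := (p - p₀) * ρ ^ (-lam)) (by positivity) hρ
    rwa [mul_assoc, hpow, mul_one, add_sub_cancel] at h
  refine ⟨hmain, ?_⟩
  have hρpow : ρ ^ (-lam) ≠ 0 := (Real.rpow_pos_of_pos hρ _).ne'
  rw [hmain]
  beta_reduce
  rw [mul_div_assoc', mul_div_mul_left _ _ hp'.ne', eq_div_iff hρpow]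
  linear_combination K 1 (p₀ + (p - p₀) * ρ ^ (-lam)) * hpow
end

section
/- Fix ε ∈ ℝ and let K_S : (0,∞) × ℝ → ℝ satisfy the scaling homogeneity K_S(e^{βε}·ρ, p₀ + e^{(2α+β)ε}·(p−p₀)) = e^{(2α+β)ε}·K_S(ρ,p) for all ρ > 0 and p ∈ ℝ. Let ρ, u, p : (0,∞) × ℝ → ℝ be differentiable with ρ > 0, satisfying the energy equation ∂p/∂t + u·∂p/∂r + K_S(ρ,p)·(∂u/∂r + k·u/r) = 0 at every point with r > 0. Define ρ̃(r,t) = e^{βε}·ρ(e^{−(1+α)ε}r, e^{−ε}t), ũ(r,t) = e^{αε}·u(e^{−(1+α)ε}r, e^{−ε}t), and p̃(r,t) = p₀ + e^{(2α+β)ε}·(p(e^{−(1+α)ε}r, e^{−ε}t) − p₀). Then (ρ̃, ũ, p̃) also satisfy the energy equation at every point with r > 0. -/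
/-- The energy equation `∂p/∂t + u·∂p/∂r + K_S(ρ,p)·(∂u/∂r + k·u/r) = 0`
at the point `(r,t)`. -/
def energyEq (k : ℝ) (KS : ℝ → ℝ → ℝ) (ρ u p : ℝ → ℝ → ℝ) (r t : ℝ) : Prop :=
  deriv (fun s => p r s) t + u r t * deriv (fun x => p x t) r
    + KS (ρ r t) (p r t) * (deriv (fun x => u x t) r + k * u r t / r) = 0

/-- if the bulk modulus `K_S` has the appropriate scaling homogeneity,
the scaling transformation generated by the symmetry group maps solutions of the
energy equation to solutions of the energy equation. -/
theorem stmt_6 (k α β ε p₀ : ℝ) (hk : k = 1 ∨ k = 2)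
    (KS : ℝ → ℝ → ℝ)
    (hKS : ∀ ρ p : ℝ, 0 < ρ →
      KS (Real.exp (β * ε) * ρ) (p₀ + Real.exp ((2 * α + β) * ε) * (p - p₀))
        = Real.exp ((2 * α + β) * ε) * KS ρ p)
    (ρ u p : ℝ → ℝ → ℝ)
    (hρpos : ∀ r t : ℝ, 0 < r → 0 < ρ r t)
    (hρ : DifferentiableOn ℝ (fun q : ℝ × ℝ => ρ q.1 q.2) (Set.Ioi 0 ×ˢ Set.univ))
    (hu : DifferentiableOn ℝ (fun q : ℝ × ℝ => u q.1 q.2) (Set.Ioi 0 ×ˢ Set.univ))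
    (hp : DifferentiableOn ℝ (fun q : ℝ × ℝ => p q.1 q.2) (Set.Ioi 0 ×ˢ Set.univ))
    (hen : ∀ r t : ℝ, 0 < r → energyEq k KS ρ u p r t) :
    ∀ r t : ℝ, 0 < r →
      energyEq k KS
        (fun r t => Real.exp (β * ε) *
          ρ (Real.exp (-(1 + α) * ε) * r) (Real.exp (-ε) * t))
        (fun r t => Real.exp (α * ε) *
          u (Real.exp (-(1 + α) * ε) * r) (Real.exp (-ε) * t))
        (fun r t => p₀ + Real.exp ((2 * α + β) * ε) *
          (p (Real.exp (-(1 + α) * ε) * r) (Real.exp (-ε) * t) - p₀))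
        r t := by
  intro r t hr
  have hc : 0 < Real.exp (-(1 + α) * ε) := Real.exp_pos _
  have hd : Real.exp (-ε) = Real.exp (α * ε) * Real.exp (-(1 + α) * ε) := by
    rw [← Real.exp_add]; congr 1; ring
  have h := hen (Real.exp (-(1 + α) * ε) * r) (Real.exp (-ε) * t) (mul_pos hc hr)
  unfold energyEq at h ⊢
  have hpt : deriv (fun s => p₀ + Real.exp ((2 * α + β) * ε) *
      (p (Real.exp (-(1 + α) * ε) * r) (Real.exp (-ε) * s) - p₀)) t
      = Real.exp ((2 * α + β) * ε) * (Real.exp (-ε) *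
        deriv (fun s => p (Real.exp (-(1 + α) * ε) * r) s) (Real.exp (-ε) * t)) := by
    rw [deriv_const_add, deriv_const_mul_field, deriv_sub_const,
      deriv_comp_mul_left (Real.exp (-ε)) (fun s => p (Real.exp (-(1 + α) * ε) * r) s) t,
      smul_eq_mul]
  have hpr : deriv (fun x => p₀ + Real.exp ((2 * α + β) * ε) *
      (p (Real.exp (-(1 + α) * ε) * x) (Real.exp (-ε) * t) - p₀)) r
      = Real.exp ((2 * α + β) * ε) * (Real.exp (-(1 + α) * ε) *
        deriv (fun x => p x (Real.exp (-ε) * t)) (Real.exp (-(1 + α) * ε) * r)) := by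
    rw [deriv_const_add, deriv_const_mul_field, deriv_sub_const,
      deriv_comp_mul_left (Real.exp (-(1 + α) * ε)) (fun x => p x (Real.exp (-ε) * t)) r,
      smul_eq_mul]
  have hur : deriv (fun x => Real.exp (α * ε) *
      u (Real.exp (-(1 + α) * ε) * x) (Real.exp (-ε) * t)) r
      = Real.exp (α * ε) * (Real.exp (-(1 + α) * ε) *
        deriv (fun x => u x (Real.exp (-ε) * t)) (Real.exp (-(1 + α) * ε) * r)) := by
    rw [deriv_const_mul_field,
      deriv_comp_mul_left (Real.exp (-(1 + α) * ε)) (fun x => u x (Real.exp (-ε) * t)) r,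
      smul_eq_mul]
  have hdiv (v : ℝ) : k * (Real.exp (α * ε) * v) / r
      = Real.exp (-ε) * (k * v / (Real.exp (-(1 + α) * ε) * r)) := by
    rw [hd]; field_simp
  beta_reduce
  rw [hpt, hpr, hur, hKS _ _ (hρpos _ _ (mul_pos hc hr)), hdiv]
  linear_combination (Real.exp ((2 * α + β) * ε) * Real.exp (-ε)) * h
    - Real.exp ((2 * α + β) * ε)
      * (u (Real.exp (-(1 + α) * ε) * r) (Real.exp (-ε) * t)
          * deriv (fun x => p x (Real.exp (-ε) * t)) (Real.exp (-(1 + α) * ε) * r)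
        + KS (ρ (Real.exp (-(1 + α) * ε) * r) (Real.exp (-ε) * t))
            (p (Real.exp (-(1 + α) * ε) * r) (Real.exp (-ε) * t))
          * deriv (fun x => u x (Real.exp (-ε) * t)) (Real.exp (-(1 + α) * ε) * r)) * hd
end

section
/- Fix k ∈ {1,2} and α, β ∈ ℝ. Let R, V, Π : I → ℝ be differentiable on an interval I ⊆ (0,∞), set X(ξ) := (1+α)·ξ + V(ξ), and suppose at a point ξ ∈ I with X(ξ) ≠ 0 both the reduced mass equation −β·R + X·R' + R·(V' + k·V/ξ) = 0 and the reduced momentum equation −α·V + X·V' + Π'/R = 0 hold (with R(ξ) ≠ 0). Then the conservation (flux) identity (R·X² + Π)'(ξ) = (2 + k + (3+k)·α + β − k·X(ξ)/ξ − α·(1+α)·ξ/X(ξ))·R(ξ)·X(ξ) holds at ξ. -/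
/-- the reduced mass and momentum equations imply the conservation
(flux) identity `(RX² + Π)' = (2 + k + (3+k)α + β − kX/ξ − α(1+α)ξ/X)·RX` at any
point `ξ` of an interval `I ⊆ (0,∞)` with `X(ξ) ≠ 0`, `R(ξ) ≠ 0`, where
`X = (1+α)ξ + V`. -/
theorem stmt_14 (k α β : ℝ) (hk : k = 1 ∨ k = 2)
    (I : Set ℝ) (hI : I ⊆ Set.Ioi 0) (hIint : I.OrdConnected)
    (R V P : ℝ → ℝ) (ξ : ℝ) (hξ : ξ ∈ I)
    (R' V' P' : ℝ)
    (hR : HasDerivAt R R' ξ) (hV : HasDerivAt V V' ξ) (hP : HasDerivAt P P' ξ)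
    (hX0 : (1 + α) * ξ + V ξ ≠ 0) (hR0 : R ξ ≠ 0)
    (hmass : -β * R ξ + ((1 + α) * ξ + V ξ) * R'
        + R ξ * (V' + k * V ξ / ξ) = 0)
    (hmom : -α * V ξ + ((1 + α) * ξ + V ξ) * V' + P' / R ξ = 0) :
    HasDerivAt (fun x => R x * ((1 + α) * x + V x) ^ 2 + P x)
      ((2 + k + (3 + k) * α + β - k * ((1 + α) * ξ + V ξ) / ξ
          - α * (1 + α) * ξ / ((1 + α) * ξ + V ξ))
        * (R ξ * ((1 + α) * ξ + V ξ))) ξ := by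
  have hξ0 : ξ ≠ 0 := (Set.mem_Ioi.mp (hI hξ)).ne'
  have hX : HasDerivAt (fun x => (1 + α) * x + V x) ((1 + α) * 1 + V') ξ :=
    ((hasDerivAt_id ξ).const_mul (1 + α)).add hV
  have hP' : P' = R ξ * (α * V ξ - ((1 + α) * ξ + V ξ) * V') := by
    field_simp at hmom
    linear_combination hmom
  have hflux : (2 + k + (3 + k) * α + β - k * ((1 + α) * ξ + V ξ) / ξ
          - α * (1 + α) * ξ / ((1 + α) * ξ + V ξ)) * (R ξ * ((1 + α) * ξ + V ξ))
      = R ξ * ((1 + α) * ξ + V ξ) * (β - k * V ξ / ξ + 2 * (1 + α)) + R ξ * (α * V ξ) := by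
    field_simp
    ring
  refine ((hR.mul (hX.pow 2)).add hP).congr_deriv ?_
  rw [hflux, hP']
  simp only [Pi.pow_apply]
  push_cast
  linear_combination ((1 + α) * ξ + V ξ) * hmass
end
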